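/- arXiv:2305.19243 — 3 statements merged into one kernel-verified Lean document; each statement's English description precedes it below -/
import Mathlib

section
/- Let H be a measurable hypothesis space, Z a measurable data space, D a probability measure on Z, and ℓ : H × Z → ℝ a measurable loss. Fix m ∈ ℕ with m ≥ 1 and γ > 0. Then for any probability measures P, Q on H with Q ≪ P and KL(Q‖P) < ∞, one has E_{S∼D^m}[ exp( γ m ( E_{h∼Q} ℓ(h;D) − E_{h∼Q} ℓ(h;S) ) − KL(Q‖P) ) ] ≤ E_{h∼P} E_{S∼D^m}[ exp( γ m ( ℓ(h;D) − ℓ(h;S) ) ) ], assuming all integrals appearing are well defined. -/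
open MeasureTheory Real

theorem dv_aux {H : Type*} [MeasurableSpace H]
    (P Q : Measure H) [IsProbabilityMeasure P] [IsProbabilityMeasure Q]
    (hQP : Q ≪ P) (hKL : Integrable (llr Q P) Q) (f : H → ℝ)
    (hf : Integrable f Q) (hexp : Integrable (fun h => Real.exp (f h)) P) :
    Real.exp ((∫ h, f h ∂Q) - ∫ h, llr Q P h ∂Q) ≤ ∫ h, Real.exp (f h) ∂P := by
  have hprob := isProbabilityMeasure_tilted hexp
  have hac : Q ≪ P.tilted f := hQP.trans (absolutelyContinuous_tilted hexp)
  have h1 := integral_llr_tilted_right hQP hf hexp hKL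
  have h2 := integrable_llr_tilted_right hQP hf hKL hexp
  have h3 := InformationTheory.integral_llr_add_sub_measure_univ_nonneg hac h2
  simp at h3
  have hpos : 0 < ∫ h, Real.exp (f h) ∂P := integral_exp_pos hexp
  rw [← Real.le_log_iff_exp_le hpos]
  linarith

/-- The change-of-measure step in the proof of the PAC-Bayes bound:
the exponential moment of the posterior gap penalized by the KL divergence is
bounded by the exponential moment of the gap under the prior. -/
theorem exp_moment_posterior_le_prior
    {H Z : Type*} [MeasurableSpace H] [MeasurableSpace Z]
    (D : Measure Z) [IsProbabilityMeasure D]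
    (ℓ : H → Z → ℝ) (hℓ : Measurable (Function.uncurry ℓ))
    (m : ℕ) (hm : 1 ≤ m)
    (γ : ℝ) (hγ : 0 < γ)
    (P Q : Measure H) [IsProbabilityMeasure P] [IsProbabilityMeasure Q]
    (hQP : Q ≪ P) (hKL : Integrable (llr Q P) Q)
    (hIntPop : Integrable (fun h => ∫ z, ℓ h z ∂D) Q)
    (hIntEmp : ∀ S : Fin m → Z,
      Integrable (fun h => (1 / (m : ℝ)) * ∑ i, ℓ h (S i)) Q)
    (hIntPrior : Integrable
      (fun p : H × (Fin m → Z) => Real.exp (γ * (m : ℝ) *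
        ((∫ z, ℓ p.1 z ∂D) - (1 / (m : ℝ)) * ∑ i, ℓ p.1 (p.2 i))))
      (P.prod (Measure.pi fun _ : Fin m => D)))
    (hIntPost : Integrable
      (fun S : Fin m → Z => Real.exp (γ * (m : ℝ) *
          ((∫ h, ∫ z, ℓ h z ∂D ∂Q) - ∫ h, (1 / (m : ℝ)) * ∑ i, ℓ h (S i) ∂Q)
        - ∫ h, llr Q P h ∂Q))
      (Measure.pi fun _ : Fin m => D)) :
    ∫ S, Real.exp (γ * (m : ℝ) *
          ((∫ h, ∫ z, ℓ h z ∂D ∂Q) - ∫ h, (1 / (m : ℝ)) * ∑ i, ℓ h (S i) ∂Q)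
        - ∫ h, llr Q P h ∂Q)
      ∂(Measure.pi fun _ : Fin m => D)
    ≤ ∫ h, ∫ S, Real.exp (γ * (m : ℝ) *
          ((∫ z, ℓ h z ∂D) - (1 / (m : ℝ)) * ∑ i, ℓ h (S i)))
      ∂(Measure.pi fun _ : Fin m => D) ∂P := by
  have hswap := integral_integral_swap (μ := P) (ν := Measure.pi fun _ : Fin m => D)
    (f := fun h S => Real.exp (γ * (m : ℝ) *
          ((∫ z, ℓ h z ∂D) - (1 / (m : ℝ)) * ∑ i, ℓ h (S i)))) hIntPrior
  refine le_of_le_of_eq ?_ hswap.symm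
  refine integral_mono_ae hIntPost hIntPrior.integral_prod_right ?_
  filter_upwards [hIntPrior.prod_left_ae] with S hS
  have h := dv_aux P Q hQP hKL _ ((hIntPop.sub (hIntEmp S)).const_mul (γ * (m : ℝ))) hS
  rw [integral_const_mul, integral_sub' hIntPop (hIntEmp S)] at h
  exact h
end

section
/- Let P₁ and P₂ be mutually absolutely continuous probability measures on a measurable space H whose density ratio satisfies |log((dP₁/dP₂)(h))| ≤ c for P₂-almost every h, for some constant c ≥ 0. Then: (a) for every measurable g : H → [0,∞) with 0 < E_{h∼P₂}[g(h)] < ∞, one has |log E_{h∼P₁}[g(h)] − log E_{h∼P₂}[g(h)]| ≤ c; and (b) consequently, for a family of real random variables (X(h))_{h∈H} and 0 < γ₁ ≤ γ₂ < ∞, writing K_min(P) = sup_{γ ∈ [γ₁,γ₂]} (1/γ²) log( E_{h∼P} E[exp(γ X(h))] ) and assuming K_min(P₁), K_min(P₂) are finite, one has |K_min(P₁) − K_min(P₂)| ≤ c / γ₁². -/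
open MeasureTheory Real

lemma aux_one {H : Type*} [MeasurableSpace H] (P Q : Measure H) (c : ℝ)
    (hPQ : P ≤ ENNReal.ofReal (Real.exp c) • Q)
    (g : H → ℝ) (hg : ∀ h, 0 ≤ g h) (hi : Integrable g Q) :
    ∫ h, g h ∂P ≤ Real.exp c * ∫ h, g h ∂Q := by
  have h1 := integral_mono_measure hPQ (Filter.Eventually.of_forall hg)
    (hi.smul_measure ENNReal.ofReal_ne_top)
  rw [integral_smul_measure, ENNReal.toReal_ofReal (Real.exp_pos c).le, smul_eq_mul] at h1
  exact h1

lemma aux_int {H : Type*} [MeasurableSpace H] (P Q : Measure H) (c : ℝ)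
    (hPQ : P ≤ ENNReal.ofReal (Real.exp c) • Q)
    (g : H → ℝ) (hi : Integrable g Q) : Integrable g P :=
  (hi.smul_measure ENNReal.ofReal_ne_top).mono_measure hPQ

lemma aux_log (a b c : ℝ) (ha : 0 ≤ a) (hb : 0 < b) (h1 : a ≤ Real.exp c * b)
    (h2 : b ≤ Real.exp c * a) : |Real.log a - Real.log b| ≤ c := by
  have ha' : 0 < a := by
    rcases ha.lt_or_eq with h | h
    · exact h
    · rw [← h] at h2
      linarith
  have e1 := Real.log_le_log ha' h1
  have e2 := Real.log_le_log hb h2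
  rw [Real.log_mul (Real.exp_pos c).ne' hb.ne', Real.log_exp] at e1
  rw [Real.log_mul (Real.exp_pos c).ne' ha'.ne', Real.log_exp] at e2
  rw [abs_le]
  constructor <;> linarith

lemma aux_main {H : Type*} [MeasurableSpace H] (P Q : Measure H) (c : ℝ) (hc : 0 ≤ c)
    (hPQ : P ≤ ENNReal.ofReal (Real.exp c) • Q)
    (hQP : Q ≤ ENNReal.ofReal (Real.exp c) • P)
    (g : H → ℝ) (hg : ∀ h, 0 ≤ g h) :
    |Real.log (∫ h, g h ∂P) - Real.log (∫ h, g h ∂Q)| ≤ c := by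
  by_cases hi : Integrable g Q
  · have hi' := aux_int P Q c hPQ g hi
    have h1 := aux_one P Q c hPQ g hg hi
    have h2 := aux_one Q P c hQP g hg hi'
    have a0 : 0 ≤ ∫ h, g h ∂P := integral_nonneg hg
    have b0 : 0 ≤ ∫ h, g h ∂Q := integral_nonneg hg
    rcases b0.lt_or_eq with hb | hb
    · exact aux_log _ _ c a0 hb h1 h2
    · rw [← hb] at h1 ⊢
      have : ∫ h, g h ∂P = 0 := by linarith
      rw [this]
      simpa using hc
  · have hi' : ¬ Integrable g P := fun h => hi (aux_int Q P c hQP g h)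
    rw [integral_undef hi, integral_undef hi']
    simpa using hc

lemma aux_le {H : Type*} [MeasurableSpace H]
    (P₁ P₂ : Measure H) [IsProbabilityMeasure P₁] [IsProbabilityMeasure P₂]
    (h12 : P₁ ≪ P₂) (h21 : P₂ ≪ P₁) (c : ℝ)
    (hratio : ∀ᵐ h ∂P₂, |llr P₁ P₂ h| ≤ c) :
    P₁ ≤ ENNReal.ofReal (Real.exp c) • P₂ ∧ P₂ ≤ ENNReal.ofReal (Real.exp c) • P₁ := by
  have hD : P₂.withDensity (P₁.rnDeriv P₂) = P₁ := Measure.withDensity_rnDeriv_eq _ _ h12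
  have hb : ∀ᵐ h ∂P₂, P₁.rnDeriv P₂ h ≤ ENNReal.ofReal (Real.exp c) ∧
      1 ≤ ENNReal.ofReal (Real.exp c) * P₁.rnDeriv P₂ h := by
    filter_upwards [hratio, Measure.rnDeriv_lt_top P₁ P₂, Measure.rnDeriv_pos' h21]
      with h h1 h2 h3
    have hp : 0 < (P₁.rnDeriv P₂ h).toReal := ENNReal.toReal_pos h3.ne' h2.ne
    rw [llr, abs_le] at h1
    have e : P₁.rnDeriv P₂ h = ENNReal.ofReal (P₁.rnDeriv P₂ h).toReal :=
      (ENNReal.ofReal_toReal h2.ne).symm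
    rw [e, ← ENNReal.ofReal_mul (Real.exp_pos c).le]
    constructor
    · apply ENNReal.ofReal_le_ofReal
      exact (Real.log_le_iff_le_exp hp).1 h1.2
    · rw [ENNReal.one_le_ofReal]
      have := (Real.le_log_iff_exp_le hp).1 h1.1
      calc (1:ℝ) = Real.exp c * Real.exp (-c) := by rw [← Real.exp_add]; simp
        _ ≤ _ := by gcongr
  constructor
  · calc P₁ = P₂.withDensity (P₁.rnDeriv P₂) := hD.symm
      _ ≤ P₂.withDensity (fun _ => ENNReal.ofReal (Real.exp c)) :=
        withDensity_mono (hb.mono fun _ h => h.1)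
      _ = _ := withDensity_const _
  · calc P₂ = P₂.withDensity 1 := withDensity_one.symm
      _ ≤ P₂.withDensity (ENNReal.ofReal (Real.exp c) • P₁.rnDeriv P₂) :=
        withDensity_mono (hb.mono fun _ h => h.2)
      _ = ENNReal.ofReal (Real.exp c) • P₂.withDensity (P₁.rnDeriv P₂) :=
        withDensity_smul _ (Measure.measurable_rnDeriv _ _)
      _ = _ := by rw [hD]

lemma aux_sup (F G : ℝ → ℝ) (s : Set ℝ) (hs : s.Nonempty) (d : ℝ)
    (hG : BddAbove (G '' s)) (h : ∀ x ∈ s, |F x - G x| ≤ d) :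
    sSup (F '' s) ≤ sSup (G '' s) + d := by
  apply csSup_le (hs.image F)
  rintro _ ⟨x, hx, rfl⟩
  have h1 := le_csSup hG (Set.mem_image_of_mem G hx)
  have h2 := (abs_le.1 (h x hx)).2
  linarith

/-- If two mutually absolutely continuous priors have log density ratio bounded
by `c`, then (a) log-expectations of nonnegative functions under them differ by
at most `c`, and (b) the minimal exponential moment bounds `K_min` differ by at
most `c / γ₁²`. -/
theorem Kmin_lipschitz_in_prior
    {H Ω : Type*} [MeasurableSpace H] [MeasurableSpace Ω]
    (P₁ P₂ : Measure H) [IsProbabilityMeasure P₁] [IsProbabilityMeasure P₂]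
    (h12 : P₁ ≪ P₂) (h21 : P₂ ≪ P₁)
    (c : ℝ) (hc : 0 ≤ c)
    (hratio : ∀ᵐ h ∂P₂, |llr P₁ P₂ h| ≤ c)
    (μ : Measure Ω) [IsProbabilityMeasure μ]
    (X : H → Ω → ℝ)
    (γ₁ γ₂ : ℝ) (hγ₁ : 0 < γ₁) (hγ₁₂ : γ₁ ≤ γ₂)
    (F₁ F₂ : ℝ → ℝ)
    (hF₁ : F₁ = fun γ => (1 / γ ^ 2) *
      Real.log (∫ h, ∫ ω, Real.exp (γ * X h ω) ∂μ ∂P₁))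
    (hF₂ : F₂ = fun γ => (1 / γ ^ 2) *
      Real.log (∫ h, ∫ ω, Real.exp (γ * X h ω) ∂μ ∂P₂))
    (hfin₁ : BddAbove (F₁ '' Set.Icc γ₁ γ₂))
    (hfin₂ : BddAbove (F₂ '' Set.Icc γ₁ γ₂)) :
    (∀ g : H → ℝ, Measurable g → (∀ h, 0 ≤ g h) →
        Integrable g P₂ → 0 < ∫ h, g h ∂P₂ →
        |Real.log (∫ h, g h ∂P₁) - Real.log (∫ h, g h ∂P₂)| ≤ c)
    ∧ |sSup (F₁ '' Set.Icc γ₁ γ₂) - sSup (F₂ '' Set.Icc γ₁ γ₂)| ≤ c / γ₁ ^ 2 := by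
  obtain ⟨hPQ, hQP⟩ := aux_le P₁ P₂ h12 h21 c hratio
  refine ⟨fun g _ hg _ _ => aux_main P₁ P₂ c hc hPQ hQP g hg, ?_⟩
  have key : ∀ x ∈ Set.Icc γ₁ γ₂, |F₁ x - F₂ x| ≤ c / γ₁ ^ 2 := by
    intro x hx
    have hx0 : 0 < x := lt_of_lt_of_le hγ₁ hx.1
    have h := aux_main P₁ P₂ c hc hPQ hQP (fun h => ∫ ω, Real.exp (x * X h ω) ∂μ)
      (fun h => integral_nonneg fun ω => (Real.exp_pos _).le)
    subst hF₁ hF₂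
    simp only
    rw [← mul_sub, abs_mul, abs_of_pos (by positivity : (0:ℝ) < 1 / x ^ 2)]
    calc _ ≤ 1 / x ^ 2 * c := by gcongr
      _ = c / x ^ 2 := by ring
      _ ≤ c / γ₁ ^ 2 := by
        have := hx.1
        gcongr
  have hne : (Set.Icc γ₁ γ₂).Nonempty := Set.nonempty_Icc.2 hγ₁₂
  have s1 := aux_sup F₁ F₂ _ hne _ hfin₂ key
  have s2 := aux_sup F₂ F₁ _ hne _ hfin₁ (fun x hx => by rw [abs_sub_comm]; exact key x hx)
  rw [abs_le]
  constructor <;> linarith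
end

section
/- Fix d ∈ ℕ, a partition of the coordinates {1,…,d} into k blocks of sizes d₁,…,d_k with d₁+⋯+d_k = d, vectors h, h₀ ∈ ℝ^d, σ ∈ ℝ^d with σ_j > 0 for all j, and constants a, b > 0. For v ∈ [−b, a]^k, let P_v be the Gaussian measure on ℝ^d with mean h₀ and diagonal covariance equal to e^{−v_i} on each coordinate of the i-th block, and let Q = N(h, diag(σ)) be the Gaussian measure with mean h and diagonal covariance diag(σ). Then the map v ↦ KL(Q‖P_v) satisfies, for all v, ṽ ∈ [−b, a]^k: |KL(Q‖P_v) − KL(Q‖P_ṽ)| ≤ (1/2) · max{ d, e^{a} ( ‖σ‖₁ + ‖h − h₀‖₂² ) } · ‖v − ṽ‖₁. -/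
open MeasureTheory ProbabilityTheory Real

lemma pi_withDensity_aux {d : ℕ} (P : Fin d → Measure ℝ) [∀ j, IsProbabilityMeasure (P j)]
    (r : Fin d → ℝ → ENNReal) (hr : ∀ j, Measurable (r j))
    [∀ j, IsProbabilityMeasure ((P j).withDensity (r j))] :
    Measure.pi (fun j => (P j).withDensity (r j))
      = (Measure.pi P).withDensity (fun x => ∏ j, r j (x j)) := by
  apply Measure.pi_eq
  intro s hs
  have hms : MeasurableSet (Set.pi Set.univ s) := MeasurableSet.univ_pi hs
  rw [withDensity_apply _ hms, ← lintegral_indicator hms]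
  have h1 : (Set.pi Set.univ s).indicator (fun x : Fin d → ℝ => ∏ j, r j (x j))
      = fun x => ∏ j, (s j).indicator (r j) (x j) := by
    funext x
    classical
    by_cases hx : x ∈ Set.pi Set.univ s
    · rw [Set.indicator_of_mem hx]
      refine Finset.prod_congr rfl fun j _ => ?_
      rw [Set.indicator_of_mem (hx j (Set.mem_univ _))]
    · rw [Set.indicator_of_notMem hx]
      simp only [Set.mem_pi, Set.mem_univ, true_imp_iff, not_forall] at hx
      obtain ⟨j, hj⟩ := hx
      exact (Finset.prod_eq_zero (Finset.mem_univ j) (Set.indicator_of_notMem hj _)).symm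
  rw [h1]
  have hm : ∀ j, Measurable ((s j).indicator (r j)) := fun j => (hr j).indicator (hs j)
  have hind := iIndepFun_pi (μ := P) (X := fun j => (s j).indicator (r j))
    (fun j => (hm j).aemeasurable)
  rw [lintegral_prod_eq_prod_lintegral_of_indepFun Finset.univ _ hind
    (fun j => (hm j).comp (measurable_pi_apply j))]
  refine Finset.prod_congr rfl fun j _ => ?_
  rw [withDensity_apply _ (hs j), ← lintegral_indicator (hs j)]
  exact (measurePreserving_eval P j).lintegral_comp (hm j)

/-- log-ratio -/
noncomputable def lgr (m m₀ : ℝ) (s t : ℝ) (x : ℝ) : ℝ :=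
  (log t - log s) / 2 + (x - m₀) ^ 2 / (2 * t) - (x - m) ^ 2 / (2 * s)

lemma lgr_meas (m m₀ s t : ℝ) : Measurable (lgr m m₀ s t) := by
  unfold lgr; fun_prop

lemma gaussian_wd (m m₀ : ℝ) (s t : NNReal) (hs : 0 < s) (ht : 0 < t) :
    gaussianReal m s =
      (gaussianReal m₀ t).withDensity (fun x => ENNReal.ofReal (exp (lgr m m₀ s t x))) := by
  have hm := lgr_meas m m₀ s t
  rw [gaussianReal_of_var_ne_zero _ hs.ne', gaussianReal_of_var_ne_zero _ ht.ne',
    ← withDensity_mul _ (measurable_gaussianPDF _ _) (by fun_prop)]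
  congr 1
  funext x
  simp only [Pi.mul_apply, gaussianPDF]
  rw [← ENNReal.ofReal_mul (gaussianPDFReal_nonneg _ _ _)]
  congr 1
  have hs' : (0:ℝ) < s := hs
  have ht' : (0:ℝ) < t := ht
  have key : ∀ (μ : ℝ) (w : NNReal), (0:ℝ) < w → gaussianPDFReal μ w x =
      exp (-(log (2 * π) + log w) / 2 - (x - μ) ^ 2 / (2 * w)) := by
    intro μ w hw
    have e1 : -(log (2 * π) + log w) / 2 - (x - μ) ^ 2 / (2 * w)
        = -log (√(2 * π * w)) + -(x - μ) ^ 2 / (2 * w) := by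
      rw [Real.log_sqrt (by positivity), Real.log_mul (by positivity) hw.ne']
      ring
    rw [e1, Real.exp_add, Real.exp_neg, Real.exp_log (by positivity), gaussianPDFReal]
  rw [key _ _ hs', key _ _ ht', ← Real.exp_add]
  congr 1
  unfold lgr
  ring

lemma int_sq (m m₀ : ℝ) (s : NNReal) : Integrable (fun x => (x - m₀)^2) (gaussianReal m s) ∧
    ∫ x, (x - m₀)^2 ∂(gaussianReal m s) = s + (m - m₀)^2 := by
  have hL := memLp_id_gaussianReal (μ := m) (v := s) 2
  have hL1 := memLp_id_gaussianReal (μ := m) (v := s) 1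
  have h2 : Integrable (fun x => (x - m) ^ 2) (gaussianReal m s) :=
    (hL.sub (memLp_const m)).integrable_sq
  have h1 : Integrable (fun x : ℝ => x) (gaussianReal m s) := memLp_one_iff_integrable.1 hL1
  have hv := variance_fun_id_gaussianReal (μ := m) (v := s)
  rw [variance_eq_integral (by fun_prop), integral_id_gaussianReal] at hv
  have he : (fun x : ℝ => (x - m₀)^2) =
      fun x => (x - m)^2 + ((2 * (m - m₀)) * x + (-(2 * (m - m₀)) * m + (m - m₀)^2)) := by
    funext x; ring
  have h3 : Integrable (fun x : ℝ => (2 * (m - m₀)) * x + (-(2 * (m - m₀)) * m + (m - m₀)^2))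
      (gaussianReal m s) := (h1.const_mul _).add (integrable_const _)
  rw [he]
  refine ⟨h2.add h3, ?_⟩
  rw [integral_add h2 h3, hv, integral_add (h1.const_mul _) (integrable_const _),
    integral_const_mul, integral_id_gaussianReal]
  simp

lemma int_lgr (m m₀ : ℝ) (s : NNReal) (t : ℝ) (hs : 0 < s) :
    Integrable (lgr m m₀ s t) (gaussianReal m s) ∧
    ∫ x, lgr m m₀ s t x ∂(gaussianReal m s) =
      (log t - log s) / 2 + (s + (m - m₀)^2) / (2 * t) - 1 / 2 := by
  obtain ⟨h1, h1'⟩ := int_sq m m₀ s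
  obtain ⟨h2, h2'⟩ := int_sq m m s
  have h3 : Integrable (fun x => (log t - log s) / 2 + (x - m₀) ^ 2 / (2 * t))
    (gaussianReal m s) := (integrable_const _).add (h1.div_const _)
  have hs' : (0:ℝ) < s := hs
  unfold lgr
  refine ⟨h3.sub (h2.div_const _), ?_⟩
  rw [integral_sub h3 (h2.div_const _), integral_add (integrable_const _) (h1.div_const _),
    integral_div (2 * t), integral_div (2 * (s : ℝ)), h1', h2']
  simp
  field_simp

lemma kl_formula {d : ℕ} (h h₀ : Fin d → ℝ) (σ τ : Fin d → NNReal)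
    (hσ : ∀ j, 0 < σ j) (hτ : ∀ j, 0 < τ j) :
    ∫ x, llr (Measure.pi fun j => gaussianReal (h j) (σ j))
      (Measure.pi fun j => gaussianReal (h₀ j) (τ j)) x
      ∂(Measure.pi fun j => gaussianReal (h j) (σ j)) =
    ∑ j, ((log (τ j) - log (σ j)) / 2 + (σ j + (h j - h₀ j)^2) / (2 * τ j) - 1 / 2) := by
  set Q := Measure.pi fun j => gaussianReal (h j) (σ j) with hQ
  set P := Measure.pi fun j => gaussianReal (h₀ j) (τ j) with hP
  have hm := fun j => lgr_meas (h j) (h₀ j) (σ j) (τ j)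
  have hwd := fun j => gaussian_wd (h j) (h₀ j) (σ j) (τ j) (hσ j) (hτ j)
  have hQP : Q = P.withDensity
      (fun x => ∏ j, ENNReal.ofReal (exp (lgr (h j) (h₀ j) (σ j) (τ j) (x j)))) := by
    have : ∀ j, IsProbabilityMeasure ((gaussianReal (h₀ j) (τ j)).withDensity
        (fun x => ENNReal.ofReal (exp (lgr (h j) (h₀ j) (σ j) (τ j) x)))) := by
      intro j; rw [← hwd j]; infer_instance
    rw [hP, ← pi_withDensity_aux _ (fun j x =>
      ENNReal.ofReal (exp (lgr (h j) (h₀ j) (σ j) (τ j) x))) (fun j => by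
        have := hm j; fun_prop), hQ]
    congr 1
    funext j
    exact hwd j
  have hmeas : Measurable (fun x : Fin d → ℝ =>
      ∏ j, ENNReal.ofReal (exp (lgr (h j) (h₀ j) (σ j) (τ j) (x j)))) :=
    Finset.measurable_fun_prod _ fun j _ => by
      have := (hm j).comp (measurable_pi_apply (X := fun _ : Fin d => ℝ) j)
      exact ENNReal.measurable_ofReal.comp (Real.measurable_exp.comp this)
  have hac : Q ≪ P := by rw [hQP]; exact withDensity_absolutelyContinuous _ _
  have hrn := Measure.rnDeriv_withDensity P hmeas
  rw [← hQP] at hrn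
  have hllr : llr Q P =ᵐ[Q] fun x => ∑ j, lgr (h j) (h₀ j) (σ j) (τ j) (x j) := by
    filter_upwards [hac.ae_le hrn] with x hx
    rw [llr, hx, ENNReal.toReal_prod, Real.log_prod]
    · refine Finset.sum_congr rfl fun j _ => ?_
      rw [ENNReal.toReal_ofReal (Real.exp_pos _).le, Real.log_exp]
    · intro j _
      rw [ENNReal.toReal_ofReal (Real.exp_pos _).le]
      exact (Real.exp_pos _).ne'
  rw [integral_congr_ae hllr, integral_finsetSum]
  · refine Finset.sum_congr rfl fun j _ => ?_
    obtain ⟨h1, h2⟩ := int_lgr (h j) (h₀ j) (σ j) (τ j) (hσ j)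
    rw [← h2, hQ]
    exact integral_comp_eval (μ := fun j => gaussianReal (h j) (σ j)) h1.1
  · intro j _
    exact integrable_comp_eval (μ := fun j => gaussianReal (h j) (σ j))
      (int_lgr (h j) (h₀ j) (σ j) (τ j) (hσ j)).1

lemma exp_lip {a x y : ℝ} (hx : x ≤ a) (hy : y ≤ x) : exp x - exp y ≤ exp a * (x - y) := by
  have h1 : exp y = exp x * exp (y - x) := by rw [← Real.exp_add]; congr 1; ring
  have h2 := Real.add_one_le_exp (y - x)
  have h3 := Real.exp_le_exp.2 hx
  have h4 := Real.exp_pos x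
  rw [h1]
  nlinarith

lemma term_bound {a x y S n D T : ℝ} (hx : x ≤ a) (hy : y ≤ a) (hS : 0 ≤ S) (hn : 0 ≤ n)
    (hnD : n ≤ D) (hST : S ≤ T) :
    |S * (exp x - exp y) - n * (x - y)| ≤ max D (exp a * T) * |x - y| := by
  wlog hxy : y ≤ x generalizing x y
  · have := this hy hx (le_of_not_ge hxy)
    rw [abs_sub_comm y x] at this
    rw [← abs_neg]
    convert this using 2
    ring
  have h0 : 0 ≤ x - y := sub_nonneg.2 hxy
  rw [abs_of_nonneg h0]
  have h1 := exp_lip hx hxy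
  have h2 : 0 ≤ exp x - exp y := sub_nonneg.2 (Real.exp_le_exp.2 hxy)
  have h3 : D * (x - y) ≤ max D (exp a * T) * (x - y) :=
    mul_le_mul_of_nonneg_right (le_max_left _ _) h0
  have h4 : (exp a * T) * (x - y) ≤ max D (exp a * T) * (x - y) :=
    mul_le_mul_of_nonneg_right (le_max_right _ _) h0
  have h5 : n * (x - y) ≤ D * (x - y) := mul_le_mul_of_nonneg_right hnD h0
  have h6 : S * (exp x - exp y) ≤ T * (exp a * (x - y)) :=
    mul_le_mul hST h1 h2 (hS.trans hST)
  have h7 : 0 ≤ n * (x - y) := mul_nonneg hn h0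
  have h8 : 0 ≤ S * (exp x - exp y) := mul_nonneg hS h2
  rw [abs_le]
  constructor <;> linarith

/-- Lipschitz continuity of the Gaussian KL divergence in the log-variance
parametrization of the layerwise prior (first item of Corollary 5.1):
`|KL(Q‖P_v) − KL(Q‖P_ṽ)| ≤ (1/2) max{d, e^a(‖σ‖₁ + ‖h−h₀‖₂²)} ‖v − ṽ‖₁`. -/
theorem gaussian_kl_lipschitz_in_log_variance
    (d k : ℕ) (blk : Fin d → Fin k)
    (h h₀ : Fin d → ℝ)
    (σ : Fin d → NNReal) (hσ : ∀ j, 0 < σ j)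
    (a b : ℝ) (ha : 0 < a) (hb : 0 < b)
    (Q : Measure (Fin d → ℝ))
    (hQ : Q = Measure.pi fun j => gaussianReal (h j) (σ j))
    (Pv : (Fin k → ℝ) → Measure (Fin d → ℝ))
    (hPv : Pv = fun v => Measure.pi fun j =>
      gaussianReal (h₀ j) (Real.exp (-v (blk j))).toNNReal)
    (v v' : Fin k → ℝ)
    (hv : ∀ i, v i ∈ Set.Icc (-b) a)
    (hv' : ∀ i, v' i ∈ Set.Icc (-b) a) :
    |(∫ x, llr Q (Pv v) x ∂Q) - ∫ x, llr Q (Pv v') x ∂Q| ≤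
      (1 / 2) * max (d : ℝ)
          (Real.exp a * ((∑ j, (σ j : ℝ)) + ∑ j, (h j - h₀ j) ^ 2)) *
        ∑ i, |v i - v' i| := by
  subst hQ hPv
  have hpos : ∀ (v : Fin k → ℝ) (j : Fin d), 0 < (Real.exp (-v (blk j))).toNNReal :=
    fun v j => Real.toNNReal_pos.2 (Real.exp_pos _)
  simp only
  rw [kl_formula h h₀ σ _ hσ (hpos v), kl_formula h h₀ σ _ hσ (hpos v'), ← Finset.sum_sub_distrib]
  rw [← Finset.sum_add_distrib]
  set w : Fin d → ℝ := fun j => σ j + (h j - h₀ j) ^ 2 with hw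
  have hw0 : ∀ j, 0 ≤ w j := fun j => by positivity
  have hsum : ∑ j, ((log ((Real.exp (-v (blk j))).toNNReal : ℝ) - log (σ j)) / 2
        + (σ j + (h j - h₀ j)^2) / (2 * ((Real.exp (-v (blk j))).toNNReal : ℝ)) - 1 / 2
      - ((log ((Real.exp (-v' (blk j))).toNNReal : ℝ) - log (σ j)) / 2
        + (σ j + (h j - h₀ j)^2) / (2 * ((Real.exp (-v' (blk j))).toNNReal : ℝ)) - 1 / 2))
      = (1 / 2) * ∑ i, ((∑ j with blk j = i, w j) * (exp (v i) - exp (v' i))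
          - (∑ j with blk j = i, (1:ℝ)) * (v i - v' i)) := by
    rw [← Finset.sum_fiberwise Finset.univ blk, Finset.mul_sum]
    refine Finset.sum_congr rfl fun i _ => ?_
    rw [Finset.sum_mul, Finset.sum_mul, ← Finset.sum_sub_distrib, Finset.mul_sum]
    refine Finset.sum_congr rfl fun j hj => ?_
    rw [Finset.mem_filter] at hj
    rw [hj.2, Real.coe_toNNReal _ (Real.exp_pos _).le, Real.coe_toNNReal _ (Real.exp_pos _).le,
      Real.log_exp, Real.log_exp, Real.exp_neg, Real.exp_neg, hw]
    field_simp
    ring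
  rw [hsum, abs_mul, abs_of_pos (by norm_num : (0:ℝ) < 1 / 2), mul_assoc, Finset.mul_sum]
  refine mul_le_mul_of_nonneg_left ?_ (by norm_num)
  refine (Finset.abs_sum_le_sum_abs _ _).trans (Finset.sum_le_sum fun i _ => ?_)
  refine term_bound (hv i).2 (hv' i).2 (Finset.sum_nonneg fun j _ => hw0 j)
    (Finset.sum_nonneg fun j _ => zero_le_one) ?_ ?_
  · calc (∑ j with blk j = i, (1:ℝ)) ≤ ∑ j : Fin d, (1:ℝ) :=
        Finset.sum_le_sum_of_subset_of_nonneg (Finset.filter_subset _ _)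
          (fun _ _ _ => zero_le_one)
      _ = d := by simp
  · exact Finset.sum_le_sum_of_subset_of_nonneg (Finset.filter_subset _ _) (fun j _ _ => hw0 j)
end
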